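/- arXiv:2409.08818 — 3 statements merged into one kernel-verified Lean document; each statement's English description precedes it below -/
import Mathlib

section
/- Let n ≥ 3 be an integer and 0 < C₁ ≤ C₂ < 1 real constants. Let ρ : ℝ → ℝ be continuously differentiable with ρ(r) > 0 for all r > 0 and C₁·r ≤ ρ(r) ≤ C₂·r for all r ≥ 1. Then for every real a < (n−2)/(4(n−1)(1−C₂^{−2})) and every R₀ > 0 there exists a Lipschitz function f : ℝ → ℝ with compact support contained in (R₀, ∞) such that ∫_0^∞ [ f'(r)² ρ(r)^{n−1} + a(n−1)(n−2) ρ'(r)² ρ(r)^{n−3} f(r)² + 4a(n−1) ρ'(r) ρ(r)^{n−2} f(r) f'(r) + a(n−1)(n−2) ρ(r)^{n−3} f(r)² ] dr < 0, where f' denotes the almost-everywhere derivative of f. -/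
open MeasureTheory Filter Set

/-- A smooth bump with the data we need. -/
lemma exists_bump : ∃ χ : ℝ → ℝ, ∃ D : ℝ, 0 ≤ D ∧ ContDiff ℝ 2 χ ∧ (∀ s, |χ s| ≤ 1) ∧
    (∀ s, |deriv χ s| ≤ D) ∧ (∀ s, |deriv (deriv χ) s| ≤ D) ∧ (∀ s, s ≤ 1 → χ s = 0) ∧
    (∀ s, 2 ≤ s → χ s = 0) ∧ 0 < ∫ s in (1:ℝ)..2, χ s ^ 2 := by
  let b : ContDiffBump (3/2 : ℝ) := ⟨1/4, 1/2, by norm_num, by norm_num⟩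
  have hb : ContDiff ℝ 2 (b : ℝ → ℝ) := b.contDiff
  have hcs : HasCompactSupport (b : ℝ → ℝ) := b.hasCompactSupport
  have h1 : ContDiff ℝ 1 (deriv (b : ℝ → ℝ)) := by
    have : ContDiff ℝ (1 + 1) (b : ℝ → ℝ) := by simpa [one_add_one_eq_two] using hb
    exact (contDiff_succ_iff_deriv.1 this).2.2
  have h2 : Continuous (deriv (deriv (b : ℝ → ℝ))) := h1.continuous_deriv le_rfl
  obtain ⟨D1, hD1⟩ := h1.continuous.bounded_above_of_compact_support hcs.deriv
  obtain ⟨D2, hD2⟩ := h2.bounded_above_of_compact_support hcs.deriv.deriv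
  refine ⟨b, max D1 D2, ?_, hb, ?_, ?_, ?_, ?_, ?_, ?_⟩
  · exact le_max_of_le_left ((norm_nonneg _).trans (hD1 0))
  · intro s
    rw [abs_of_nonneg b.nonneg]
    exact b.le_one
  · intro s; exact le_max_of_le_left (hD1 s)
  · intro s; exact le_max_of_le_right (hD2 s)
  · intro s hs
    apply b.zero_of_le_dist
    rw [Real.dist_eq, abs_of_nonpos (by linarith)]
    show (1/2:ℝ) ≤ _
    linarith
  · intro s hs
    apply b.zero_of_le_dist
    rw [Real.dist_eq, abs_of_nonneg (by linarith)]
    show (1/2:ℝ) ≤ _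
    linarith
  · apply intervalIntegral.intervalIntegral_pos_of_pos_on
    · exact (hb.continuous.pow 2).intervalIntegrable _ _
    · intro s hs
      apply pow_pos
      apply b.pos_of_mem_ball
      rw [Metric.mem_ball, Real.dist_eq, abs_lt]
      show -(1/2:ℝ) < _ ∧ _ < (1/2:ℝ)
      constructor <;> linarith [hs.1, hs.2]
    · norm_num

lemma err_bound (α γ κ B ε x y z D : ℝ) (hα : 0 ≤ α) (hγ : 0 ≤ γ) (hκ : 0 ≤ κ) (hB : 0 ≤ B)
    (hε : 0 ≤ ε) (hε1 : ε ≤ 1) (hx : |x| ≤ 1) (hy : |y| ≤ D) (hz : |z| ≤ D) :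
    ε * (-(2*γ+2*α+4*B+2*γ*κ) * (x*y)) + ε^2 * (y^2 + κ*(y^2+x*z))
      ≤ ε * ((2*γ+2*α+4*B+2*γ*κ) * D + (D^2 + κ*(D^2+D))) := by
  have hxy : |x*y| ≤ D := by
    rw [abs_mul]; nlinarith [abs_nonneg x, abs_nonneg y]
  have hxz : |x*z| ≤ D := by
    rw [abs_mul]; nlinarith [abs_nonneg x, abs_nonneg z]
  have hD : 0 ≤ D := (abs_nonneg _).trans hy
  have hy2 : y^2 ≤ D^2 := sq_le_sq' (by linarith [(abs_le.1 hy).1]) (abs_le.1 hy).2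
  have hA : 0 ≤ 2*γ+2*α+4*B+2*γ*κ := by positivity
  have e1 : -(2*γ+2*α+4*B+2*γ*κ) * (x*y) ≤ (2*γ+2*α+4*B+2*γ*κ) * D := by
    nlinarith [(abs_le.1 hxy).1]
  have e2 : y^2 + κ*(y^2+x*z) ≤ D^2 + κ*(D^2+D) := by
    have := mul_le_mul_of_nonneg_left (add_le_add hy2 (abs_le.1 hxz).2) hκ
    linarith
  have e3 : 0 ≤ D^2 + κ*(D^2+D) := by positivity
  have e4 : ε^2 * (y^2 + κ*(y^2+x*z)) ≤ ε * (D^2 + κ*(D^2+D)) := by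
    calc _ ≤ ε^2 * (D^2 + κ*(D^2+D)) := by gcongr
      _ ≤ _ := by
        apply mul_le_mul_of_nonneg_right _ e3
        nlinarith
  nlinarith [mul_le_mul_of_nonneg_left e1 hε]

set_option maxHeartbeats 2000000 in
lemma ptwise (α γ κ B m ε x y z D r R l V c c1 δ : ℝ) (hα : 0 ≤ α) (hγ : 0 ≤ γ) (hκ : 0 ≤ κ)
    (hB : 0 ≤ B) (hε : 0 ≤ ε) (hε1 : ε ≤ 1) (hx : |x| ≤ 1) (hy : |y| ≤ D) (hz : |z| ≤ D)
    (hm : 0 ≤ m) (hQ : α^2 - B*m + 4*B*α = 0) (hγm : γ = m/2 - α)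
    (hκe : κ * (2*γ+1) = 2*α+4*B) (hr : 0 < r) (hR : 0 < R) (hc : c * R^2 ≤ r^2)
    (hδ : δ = B*m*c - m^2/4 - B*m) (hδ0 : 0 ≤ δ)
    (hV1 : V ≤ r) (hV2 : c1 * r ≤ V) (hV : 0 ≤ V) :
    V * ((-α*l*x + (-γ*x+ε*y)/r)^2 - B*m*l^2*x^2 - 4*B*l*x*(-α*l*x + (-γ*x+ε*y)/r)
      - B*m*x^2/R^2)
    ≤ κ * V * (((2*γ+1)*l - 2*γ/r)*((γ*x^2-ε*x*y)/r) - (γ*x^2-ε*x*y)/r^2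
        + (2*γ*x*ε*y - ε^2*(y^2+x*z))/r^2)
      + (-δ*c1*x^2 + ε * ((2*γ+2*α+4*B+2*γ*κ) * D + (D^2 + κ*(D^2+D))))/r := by
  have he := err_bound α γ κ B ε x y z D hα hγ hκ hB hε hε1 hx hy hz
  set M := (2*γ+2*α+4*B+2*γ*κ) * D + (D^2 + κ*(D^2+D)) with hM
  set E := ε * (-(2*γ+2*α+4*B+2*γ*κ) * (x*y)) + ε^2 * (y^2 + κ*(y^2+x*z)) with hE
  have hD : 0 ≤ D := (abs_nonneg _).trans hy
  have hM0 : 0 ≤ M := by positivity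
  have key : V * ((-α*l*x + (-γ*x+ε*y)/r)^2 - B*m*l^2*x^2 - 4*B*l*x*(-α*l*x + (-γ*x+ε*y)/r)
      - B*m*x^2/R^2)
    - κ * V * (((2*γ+1)*l - 2*γ/r)*((γ*x^2-ε*x*y)/r) - (γ*x^2-ε*x*y)/r^2
        + (2*γ*x*ε*y - ε^2*(y^2+x*z))/r^2)
     = V/r^2 * ((m^2/4+B*m)*x^2 + E) - V*(B*m*x^2/R^2) := by
    have h1 : m^2/4+B*m = γ^2 + γ*(κ*(2*γ+1)) := by
      rw [hκe, hγm]; linear_combination hQ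
    have h2 : B*m = α^2+4*B*α := by linarith
    have h3 : E = ε * (-(2*γ+κ*(2*γ+1)+2*γ*κ) * (x*y)) + ε^2 * (y^2 + κ*(y^2+x*z)) := by
      rw [hκe, hE]; ring
    rw [h1, h3]
    have h4 : V * ((-α*l*x + (-γ*x+ε*y)/r)^2 - B*m*l^2*x^2
        - 4*B*l*x*(-α*l*x + (-γ*x+ε*y)/r) - B*m*x^2/R^2)
        = V * (- (κ*(2*γ+1))*l*x*((-γ*x+ε*y)/r) + ((-γ*x+ε*y)/r)^2 - B*m*x^2/R^2) := by
      rw [hκe]; linear_combination V*l^2*x^2*hQ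
    rw [h4]
    field_simp
    ring
  have h5 : c / r^2 ≤ 1/R^2 := by
    rw [div_le_div_iff₀ (by positivity) (by positivity)]; linarith
  have h6 : V*(B*m*x^2) * (c/r^2) ≤ V*(B*m*x^2) * (1/R^2) :=
    mul_le_mul_of_nonneg_left h5 (by positivity)
  have h7 : V/r^2 ≤ 1/r := by
    rw [div_le_div_iff₀ (by positivity) (by positivity)]; nlinarith
  have h8 : c1/r ≤ V/r^2 := by
    rw [div_le_div_iff₀ (by positivity) (by positivity)]; nlinarith
  have h9 : V/r^2*E ≤ 1/r*(ε*M) := by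
    calc V/r^2*E ≤ V/r^2*(ε*M) := mul_le_mul_of_nonneg_left he (by positivity)
      _ ≤ _ := mul_le_mul_of_nonneg_right h7 (by positivity)
  have h10 : c1/r*(δ*x^2) ≤ V/r^2*(δ*x^2) := mul_le_mul_of_nonneg_right h8 (by positivity)
  have h11 : V/r^2 * ((m^2/4+B*m)*x^2 + E) - V*(B*m*x^2/R^2)
      ≤ V/r^2*E - V/r^2*(δ*x^2) := by
    have : V*(B*m*x^2) * (c/r^2) = V/r^2*(δ*x^2) + V/r^2*((m^2/4+B*m)*x^2) := by
      rw [hδ]; ring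
    have h' : V*(B*m*x^2) * (1/R^2) = V*(B*m*x^2/R^2) := by ring
    linarith
  have h12 : (-δ*c1*x^2 + ε*M)/r = 1/r*(ε*M) - c1/r*(δ*x^2) := by ring
  rw [h12]
  linarith

set_option maxHeartbeats 4000000 in
theorem stmt_14 (n : ℕ) (hn : 3 ≤ n) (C₁ C₂ : ℝ) (hC₁ : 0 < C₁) (hC : C₁ ≤ C₂)
    (hC₂ : C₂ < 1)
    (ρ : ℝ → ℝ) (hρ : ContDiff ℝ 1 ρ) (hρpos : ∀ r > (0 : ℝ), 0 < ρ r)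
    (hbound : ∀ r ≥ (1 : ℝ), C₁ * r ≤ ρ r ∧ ρ r ≤ C₂ * r)
    (a : ℝ) (ha : a < ((n : ℝ) - 2) / (4 * ((n : ℝ) - 1) * (1 - (C₂)⁻¹ ^ 2)))
    (R₀ : ℝ) (hR₀ : 0 < R₀) :
    ∃ f : ℝ → ℝ, (∃ K, LipschitzWith K f) ∧ HasCompactSupport f ∧
      tsupport f ⊆ Set.Ioi R₀ ∧
      (∫ r in Set.Ioi (0 : ℝ), ((deriv f r) ^ 2 * (ρ r) ^ (n - 1)
        + a * ((n : ℝ) - 1) * ((n : ℝ) - 2) * (deriv ρ r) ^ 2 * (ρ r) ^ (n - 3) * (f r) ^ 2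
        + 4 * a * ((n : ℝ) - 1) * (deriv ρ r) * (ρ r) ^ (n - 2) * (f r) * (deriv f r)
        + a * ((n : ℝ) - 1) * ((n : ℝ) - 2) * (ρ r) ^ (n - 3) * (f r) ^ 2)) < 0 := by
  obtain ⟨k, rfl⟩ : ∃ k, n = k + 3 := ⟨n - 3, by omega⟩
  have hC₂0 : 0 < C₂ := hC₁.trans_le hC
  obtain ⟨m, hm⟩ : ∃ m : ℝ, m = (k:ℝ) + 1 := ⟨_, rfl⟩
  have hm1 : 1 ≤ m := by rw [hm]; linarith [(Nat.cast_nonneg k : (0:ℝ) ≤ k)]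
  have e1 : ((k+3:ℕ):ℝ) - 1 = m + 1 := by push_cast; linarith
  have e2 : ((k+3:ℕ):ℝ) - 2 = m := by push_cast; linarith
  rw [e1, e2] at ha
  rw [e1, e2, show k + 3 - 1 = k + 2 by omega, show k + 3 - 3 = k by omega,
    show k + 3 - 2 = k + 1 by omega]
  obtain ⟨c, hc⟩ : ∃ c : ℝ, c = C₂⁻¹^2 := ⟨_, rfl⟩
  have hc1 : 1 < c := by
    rw [hc]; exact one_lt_pow₀ ((one_lt_inv₀ hC₂0).2 hC₂) (by norm_num)
  have hcC : c * C₂^2 = 1 := by rw [hc]; field_simp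
  rw [← hc] at ha
  obtain ⟨B, hBdef⟩ : ∃ B : ℝ, B = -a * (m+1) := ⟨_, rfl⟩
  have hBc : m < 4 * B * (c - 1) := by
    have hneg : 4 * (m+1) * (1 - c) < 0 := by nlinarith
    rw [lt_div_iff_of_neg hneg] at ha
    rw [hBdef]; linarith
  have hB : 0 < B := by
    by_contra h
    nlinarith
  obtain ⟨δ, hδ⟩ : ∃ δ : ℝ, δ = B*m*c - m^2/4 - B*m := ⟨_, rfl⟩
  have hδ0 : 0 < δ := by rw [hδ]; nlinarith
  -- exponents
  obtain ⟨α, hα0, hQ⟩ : ∃ α : ℝ, 0 ≤ α ∧ α^2 - B*m + 4*B*α = 0 := by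
    have hs : 0 ≤ 4*B^2 + B*m := by positivity
    refine ⟨-2*B + √(4*B^2+B*m), ?_, ?_⟩
    · have : 2*B ≤ √(4*B^2+B*m) := Real.le_sqrt_of_sq_le (by nlinarith)
      linarith
    · nlinarith [Real.sq_sqrt hs]
  have hαm : α < m/2 := by
    by_contra h
    nlinarith
  obtain ⟨γ, hγ⟩ : ∃ γ : ℝ, γ = m/2 - α := ⟨_, rfl⟩
  have hγ0 : 0 < γ := by rw [hγ]; linarith
  obtain ⟨κ, hκ⟩ : ∃ κ : ℝ, κ = (2*α+4*B)/(2*γ+1) := ⟨_, rfl⟩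
  have hκe : κ * (2*γ+1) = 2*α+4*B := by rw [hκ]; field_simp
  have hκ0 : 0 ≤ κ := by rw [hκ]; positivity
  obtain ⟨χ, D, hD, hχ, hχ1, hχ2, hχ3, hχl, hχr, hJ⟩ := exists_bump
  obtain ⟨M, hM⟩ : ∃ M : ℝ, M = (2*γ+2*α+4*B+2*γ*κ) * D + (D^2 + κ*(D^2+D)) := ⟨_, rfl⟩
  have hM0 : 0 ≤ M := by rw [hM]; positivity
  obtain ⟨J, hJdef⟩ : ∃ J : ℝ, J = ∫ s in (1:ℝ)..2, χ s ^ 2 := ⟨_, rfl⟩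
  rw [← hJdef] at hJ
  obtain ⟨c1, hc1def⟩ : ∃ c1 : ℝ, c1 = C₁ ^ (2*γ+1) := ⟨_, rfl⟩
  have hc10 : 0 < c1 := by rw [hc1def]; positivity
  -- scale
  obtain ⟨t, ht1, htR, htM⟩ : ∃ t : ℝ, 1 ≤ t ∧ Real.log R₀ < t ∧ M < t * (δ*c1*J) := by
    refine ⟨1 + |Real.log R₀| + M/(δ*c1*J), ?_, ?_, ?_⟩
    · have : 0 ≤ M/(δ*c1*J) := by positivity
      linarith [abs_nonneg (Real.log R₀)]
    · have : 0 ≤ M/(δ*c1*J) := by positivity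
      linarith [le_abs_self (Real.log R₀)]
    · have h1 : M/(δ*c1*J) * (δ*c1*J) = M := by field_simp
      have h2 : 0 < δ*c1*J := by positivity
      nlinarith [abs_nonneg (Real.log R₀)]
  have ht0 : 0 < t := by linarith
  obtain ⟨ε, hε⟩ : ∃ ε : ℝ, ε = 1/t := ⟨_, rfl⟩
  have hε0 : 0 < ε := by rw [hε]; positivity
  have hε1 : ε ≤ 1 := by rw [hε, div_le_one ht0]; exact ht1
  have hεt : ε * t = 1 := by rw [hε]; field_simp
  have hεM : ε * M < δ*c1*J := by
    calc ε * M < ε * (t * (δ*c1*J)) := mul_lt_mul_of_pos_left htM hε0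
      _ = δ*c1*J := by rw [← mul_assoc, hεt, one_mul]
  obtain ⟨A, hA⟩ : ∃ A : ℝ, A = Real.exp t := ⟨_, rfl⟩
  obtain ⟨Z, hZ⟩ : ∃ Z : ℝ, Z = Real.exp (2*t) := ⟨_, rfl⟩
  have hA1 : 1 < A := by rw [hA]; exact Real.one_lt_exp_iff.2 ht0
  have hAZ : A ≤ Z := by rw [hA, hZ]; exact Real.exp_le_exp.2 (by linarith)
  have hAR : R₀ < A := by rw [hA]; exact (Real.log_lt_iff_lt_exp hR₀).1 htR
  have hlA : ε * Real.log A = 1 := by rw [hA, Real.log_exp, hεt]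
  have hlZ : ε * Real.log Z = 2 := by rw [hZ, Real.log_exp]; linarith
  -- the functions
  have hχd : Differentiable ℝ χ := hχ.differentiable (by norm_num)
  have hχ1d : ContDiff ℝ 1 (deriv χ) := by
    have : ContDiff ℝ (1 + 1) χ := by simpa [one_add_one_eq_two] using hχ
    exact (contDiff_succ_iff_deriv.1 this).2.2
  have hχd2 : Differentiable ℝ (deriv χ) := hχ1d.differentiable (by norm_num)
  have hρd : Differentiable ℝ ρ := hρ.differentiable (by norm_num)
  have hρ' : Continuous (deriv ρ) := hρ.continuous_deriv le_rfl
  let g : ℝ → ℝ := fun r => (ρ r)^(-α) * r^(-γ) * χ (ε * Real.log r)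
  let f : ℝ → ℝ := (Ioi (0:ℝ)).indicator g
  have hfg : ∀ r, 0 < r → f r = g r := fun r hr => indicator_of_mem (show r ∈ Ioi (0:ℝ) from hr) g
  have hfout : ∀ r, r ∉ Icc A Z → f r = 0 := by
    intro r hr
    by_cases h0 : 0 < r
    · rw [hfg r h0]
      have : χ (ε * Real.log r) = 0 := by
        rcases lt_or_ge r A with h | h
        · apply hχl
          rw [← hlA]
          exact mul_le_mul_of_nonneg_left (Real.log_le_log h0 h.le) hε0.le
        · apply hχr
          have : Z ≤ r := by
            by_contra h'
            exact hr ⟨h, (not_le.1 h').le⟩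
          rw [← hlZ]
          exact mul_le_mul_of_nonneg_left (Real.log_le_log (by linarith) this) hε0.le
      simp [g, this]
    · exact indicator_of_notMem (show r ∉ Ioi (0:ℝ) from h0) g
  have hts : tsupport f ⊆ Icc A Z := by
    apply closure_minimal _ isClosed_Icc
    intro r hr
    by_contra h
    exact hr (hfout r h)
  have hfcs : HasCompactSupport f := isCompact_Icc.of_isClosed_subset (isClosed_tsupport f) hts
  have hf1 : ContDiff ℝ 1 f := by
    rw [contDiff_iff_contDiffAt]
    intro r
    rcases lt_or_ge 0 r with h | h
    · have hev : f =ᶠ[nhds r] g := by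
        filter_upwards [Ioi_mem_nhds h] with s hs using hfg s hs
      refine ContDiffAt.congr_of_eventuallyEq ?_ hev
      refine ((hρ.contDiffAt.rpow_const_of_ne (hρpos r h).ne').mul
        (contDiffAt_id.rpow_const_of_ne h.ne')).mul ?_
      have hl : ContDiffAt ℝ 1 (fun r => ε * Real.log r) r :=
        contDiffAt_const.mul (Real.contDiffAt_log.2 h.ne')
      exact ((hχ.of_le (by norm_num)).contDiffAt (x := ε * Real.log r)).comp r hl
    · have hev : f =ᶠ[nhds r] fun _ => 0 := by
        filter_upwards [Iio_mem_nhds (show r < A by linarith)] with s hs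
        exact hfout s (fun h' => absurd h'.1 (not_le.2 hs))
      exact contDiffAt_const.congr_of_eventuallyEq hev
  have hf' : Continuous (deriv f) := hf1.continuous_deriv le_rfl
  refine ⟨f, hf1.lipschitzWith_of_hasCompactSupport hfcs (by norm_num), hfcs, ?_, ?_⟩
  · intro r hr
    exact hAR.trans_le (hts hr).1
  have hdout : ∀ r, r ∉ Icc A Z → deriv f r = 0 := by
    intro r hr
    by_contra h
    exact hr (hts (support_deriv_subset h))
  set F : ℝ → ℝ := fun r => (deriv f r) ^ 2 * (ρ r) ^ (k + 2)
        + a * (m + 1) * m * (deriv ρ r) ^ 2 * (ρ r) ^ k * (f r) ^ 2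
        + 4 * a * (m + 1) * (deriv ρ r) * (ρ r) ^ (k + 1) * (f r) * (deriv f r)
        + a * (m + 1) * m * (ρ r) ^ k * (f r) ^ 2 with hF
  have hFc : Continuous F := by
    have := hf1.continuous
    have := hρ.continuous
    fun_prop
  have hI : ∫ r in Ioi (0:ℝ), F r = ∫ r in A..Z, F r := by
    rw [intervalIntegral.integral_of_le hAZ, ← integral_Icc_eq_integral_Ioc]
    apply setIntegral_eq_of_subset_of_forall_sdiff_eq_zero measurableSet_Ioi
    · intro r hr
      exact lt_of_lt_of_le (by linarith) hr.1
    · intro r hr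
      simp [F, hfout r hr.2, hdout r hr.2]
  rw [hI]
  let V : ℝ → ℝ := fun r => (ρ r)^(2*γ+1) * r^(-(2*γ))
  let h : ℝ → ℝ := fun s => -δ*c1*(χ s)^2 + ε * M
  have hhc : Continuous h := by
    have := hχ.continuous
    fun_prop
  let H : ℝ → ℝ := fun s => ∫ u in (1:ℝ)..s, h u
  have hH : ∀ s, HasDerivAt H (h s) s := fun s => 
    intervalIntegral.integral_hasDerivAt_right (hhc.intervalIntegrable _ _)
      (hhc.stronglyMeasurableAtFilter _ _) hhc.continuousAt
  have hH1 : H 1 = 0 := by simp [H]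
  have hH2 : H 2 < 0 := by
    have : H 2 = -δ*c1*J + ε*M := by
      simp only [H, h]
      rw [intervalIntegral.integral_add, intervalIntegral.integral_const_mul, ← hJdef]
      · simp; left; norm_num
      · exact (continuous_const.mul (hχ.continuous.pow 2)).intervalIntegrable _ _
      · exact continuous_const.intervalIntegrable _ _
    rw [this]; linarith
  let X : ℝ → ℝ := fun r => χ (ε * Real.log r)
  let Y : ℝ → ℝ := fun r => deriv χ (ε * Real.log r)
  let G : ℝ → ℝ := fun r => κ * (V r * ((γ * X r^2 - ε * (X r * Y r)) / r))
    + H (ε * Real.log r) / ε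
  have hlog : ∀ r, 0 < r → HasDerivAt (fun r => ε * Real.log r) (ε / r) r := by
    intro r hr
    simpa [div_eq_mul_inv] using (Real.hasDerivAt_log hr.ne').const_mul ε
  have hX : ∀ r, 0 < r → HasDerivAt X (Y r * (ε / r)) r := fun r hr =>
    (hχd _).hasDerivAt.comp r (hlog r hr)
  have hY : ∀ r, 0 < r → HasDerivAt Y (deriv (deriv χ) (ε * Real.log r) * (ε / r)) r :=
    fun r hr => (hχd2 _).hasDerivAt.comp r (hlog r hr)
  have hpow : ∀ r, 0 < r → ∀ e : ℝ, HasDerivAt (fun r => r^e) (r^e * (e / r)) r := by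
    intro r hr e
    have := Real.hasDerivAt_rpow_const (x := r) (p := e) (Or.inl hr.ne')
    convert this using 1
    rw [Real.rpow_sub_one hr.ne']; ring
  have hρpow : ∀ r, 0 < r → ∀ e : ℝ,
      HasDerivAt (fun r => (ρ r)^e) ((ρ r)^e * (e * (deriv ρ r / ρ r))) r := by
    intro r hr e
    have := (hpow (ρ r) (hρpos r hr) e).comp r (hρd r).hasDerivAt
    refine this.congr_deriv ?_
    ring
  have hV : ∀ r, 0 < r →
      HasDerivAt V (V r * ((2*γ+1) * (deriv ρ r / ρ r) - 2*γ/r)) r := by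
    intro r hr
    refine ((hρpow r hr (2*γ+1)).mul (hpow r hr (-(2*γ)))).congr_deriv ?_
    simp only [V]; ring
  let G' : ℝ → ℝ := fun r => κ * V r * (((2*γ+1)*(deriv ρ r / ρ r) - 2*γ/r)
        * ((γ*(X r)^2-ε*X r*Y r)/r) - (γ*(X r)^2-ε*X r*Y r)/r^2
        + (2*γ*X r*ε*Y r - ε^2*((Y r)^2+X r*deriv (deriv χ) (ε * Real.log r)))/r^2)
      + h (ε * Real.log r) / r
  have hG : ∀ r, 0 < r → HasDerivAt G (G' r) r := by
    intro r hr
    have hx := hX r hr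
    have hy := hY r hr
    have d1 := (((hV r hr).mul (((((hx.pow 2).const_mul γ).sub
      ((hx.mul hy).const_mul ε)).div (hasDerivAt_id r) hr.ne'))).const_mul κ).add
      (((hH (ε * Real.log r)).comp r (hlog r hr)).div_const ε)
    refine d1.congr_deriv ?_
    simp only [G', Pi.div_apply, Pi.sub_apply, Pi.mul_apply, Pi.pow_apply, id]
    have hR := (hρpos r hr).ne'
    field_simp
    ring
  have hfd : ∀ r, 0 < r → deriv f r = (ρ r)^(-α) * r^(-γ) *
      (-α * (deriv ρ r / ρ r) * X r + (-γ * X r + ε * Y r)/r) := by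
    intro r hr
    have hev : f =ᶠ[nhds r] g := by
      filter_upwards [Ioi_mem_nhds hr] with s hs using hfg s hs
    rw [hev.deriv_eq]
    have d := ((hρpow r hr (-α)).mul (hpow r hr (-γ))).mul (hX r hr)
    have d' : HasDerivAt g _ r := d
    rw [d'.deriv]
    simp only [Pi.mul_apply]
    ring
  have hle : ∀ r, 1 ≤ r → F r ≤ G' r := by
    intro r hr1
    have hr : 0 < r := by linarith
    have hR := hρpos r hr
    obtain ⟨hb1, hb2⟩ := hbound r hr1
    have hVnn : 0 ≤ V r := by
      simp only [V]; positivity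
    have hVr : V r = (ρ r / r)^(2*γ+1) * r := by
      simp only [V]
      rw [Real.div_rpow hR.le hr.le, Real.rpow_neg hr.le, Real.rpow_add_one hr.ne']
      field_simp
    have hV1 : V r ≤ r := by
      rw [hVr]
      have : (ρ r / r)^(2*γ+1) ≤ 1 := by
        apply Real.rpow_le_one (by positivity) _ (by positivity)
        rw [div_le_one hr]; nlinarith
      nlinarith
    have hV2 : c1 * r ≤ V r := by
      rw [hVr, hc1def]
      apply mul_le_mul_of_nonneg_right _ hr.le
      apply Real.rpow_le_rpow hC₁.le _ (by positivity)
      rw [le_div_iff₀ hr]; exact hb1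
    have hcR : c * (ρ r)^2 ≤ r^2 := by
      have : (ρ r)^2 ≤ (C₂*r)^2 := pow_le_pow_left₀ hR.le hb2 2
      calc c * (ρ r)^2 ≤ c * (C₂*r)^2 := by
            apply mul_le_mul_of_nonneg_left this (by linarith)
        _ = (c*C₂^2) * r^2 := by ring
        _ = r^2 := by rw [hcC, one_mul]
    have main := ptwise α γ κ B m ε (X r) (Y r) (deriv (deriv χ) (ε * Real.log r)) D r (ρ r)
      (deriv ρ r / ρ r) (V r) c c1 δ hα0 hγ0.le hκ0 hB.le hε0.le hε1 (hχ1 _) (hχ2 _) (hχ3 _)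
      (by linarith) hQ hγ hκe hr hR hcR hδ hδ0.le hV1 hV2 hVnn
    rw [← hM] at main
    refine le_trans (le_of_eq ?_) main
    have hVpq : V r = ((ρ r)^(-α))^2 * (r^(-γ))^2 * (ρ r)^k * (ρ r)^2 := by
      simp only [V]
      rw [mul_assoc _ ((ρ r)^k), ← pow_add, ← Real.rpow_natCast (ρ r) (k+2),
        ← Real.rpow_natCast _ 2, ← Real.rpow_natCast _ 2, ← Real.rpow_mul hR.le,
        ← Real.rpow_mul hr.le, mul_right_comm, ← Real.rpow_add hR]
      congr 2
      · push_cast; rw [hγ, hm]; ring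
      · push_cast; ring
    have hBa : a * (m+1) = -B := by rw [hBdef]; ring
    have h4 : 4 * a * (m+1) = -(4*B) := by rw [hBdef]; ring
    simp only [F]
    rw [hBa, h4, hfd r hr, hfg r hr, hVpq]
    have hgx : g r = (ρ r)^(-α) * r^(-γ) * X r := rfl
    rw [hgx]
    field_simp
    ring
  have hA0 : 0 < A := by linarith
  have fin : ∫ r in A..Z, F r ≤ G Z - G A := by
    apply intervalIntegral.integral_le_sub_of_hasDeriv_right_of_le hAZ
    · intro r hr
      exact (hG r (hA0.trans_le hr.1)).continuousAt.continuousWithinAt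
    · intro r hr
      exact (hG r (hA0.trans hr.1)).hasDerivWithinAt
    · exact hFc.continuousOn.integrableOn_Icc
    · intro r hr
      exact hle r (by linarith [hr.1])
  have hXA : X A = 0 := hχl _ hlA.le
  have hXZ : X Z = 0 := hχr _ hlZ.ge
  have hGA : G A = 0 := by simp [G, hXA, hlA, hH1]
  have hGZ : G Z = H 2 / ε := by simp [G, hXZ, hlZ]
  rw [hGA, hGZ] at fin
  have : H 2 / ε < 0 := div_neg_of_neg_of_pos hH2 hε0
  linarith
end

section
/- Let n ≥ 3 be an integer and c a real number. Let ρ : ℝ → ℝ be continuously differentiable with ρ(r) > 0 for all r > 0, and suppose there is a real number α such that ρ(r)·r^{−γ} → 0 as r → ∞ for every γ > α, while ρ(r)·r^{−γ} does not tend to 0 for any γ < α. Suppose for some real a > (n−1)/(4n) one has ∫_0^∞ [ f'(r)² ρ(r)^{n−1} + a(n−1)(n−2) ρ'(r)² ρ(r)^{n−3} f(r)² + 4a(n−1) ρ'(r) ρ(r)^{n−2} f(r) f'(r) + a·c·ρ(r)^{n−3} f(r)² ] dr ≥ 0 for every Lipschitz f : ℝ → ℝ with compact support contained in (0, ∞)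 (f' the almost-everywhere derivative of f). Then liminf_{R→∞} (log R)^{−1} ∫_1^R r·ρ(r)^{−2} dr > 0; and if moreover c ≤ 0, then α < n/(2n−2). -/
open MeasureTheory Filter Set

lemma S_deriv_bdd : ∃ M : ℝ, 0 ≤ M ∧ ∀ x, |deriv Real.smoothTransition x| ≤ M := by
  have hc : Continuous (deriv Real.smoothTransition) :=
    (Real.smoothTransition.contDiff (n := 1)).continuous_deriv le_rfl
  obtain ⟨M, hM⟩ := (isCompact_Icc (a := (0:ℝ)) (b := 1)).exists_bound_of_continuousOn hc.continuousOn
  have hM0 : 0 ≤ M := (abs_nonneg _).trans (hM 0 (by simp))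
  refine ⟨M, hM0, fun x => ?_⟩
  by_cases h0 : x ≤ 0
  · have : deriv Real.smoothTransition x = 0 := by
      apply IsLocalMin.deriv_eq_zero
      refine Filter.Eventually.of_forall fun y => ?_
      rw [Real.smoothTransition.zero_of_nonpos h0]; exact Real.smoothTransition.nonneg y
    simpa [this] using hM0
  by_cases h1 : 1 ≤ x
  · have : deriv Real.smoothTransition x = 0 := by
      apply IsLocalMax.deriv_eq_zero
      refine Filter.Eventually.of_forall fun y => ?_
      rw [Real.smoothTransition.one_of_one_le h1]; exact Real.smoothTransition.le_one y
    simpa [this] using hM0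
  · exact hM x ⟨by linarith, by linarith⟩

lemma S_deriv_zero {x : ℝ} (h1 : 1 ≤ x) : deriv Real.smoothTransition x = 0 := by
  apply IsLocalMax.deriv_eq_zero
  refine Filter.Eventually.of_forall fun y => ?_
  rw [Real.smoothTransition.one_of_one_le h1]; exact Real.smoothTransition.le_one y

/-- the cutoff -/
noncomputable def cutoff (R r : ℝ) : ℝ :=
  Real.smoothTransition (r - 1) * Real.smoothTransition (2 - r / R)

noncomputable def cutoffD (R r : ℝ) : ℝ :=
  deriv Real.smoothTransition (r - 1) * Real.smoothTransition (2 - r / R)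
    + Real.smoothTransition (r - 1) * (deriv Real.smoothTransition (2 - r / R) * (-(1/R)))

lemma cutoff_contDiff (R : ℝ) : ContDiff ℝ 1 (cutoff R) := by
  unfold cutoff
  apply ContDiff.mul
  · exact (Real.smoothTransition.contDiff (n := 1)).comp (by fun_prop)
  · exact (Real.smoothTransition.contDiff (n := 1)).comp
      (contDiff_const.sub (contDiff_id.div_const R))

lemma cutoff_hasDerivAt (R r : ℝ) : HasDerivAt (cutoff R) (cutoffD R r) r := by
  have hS : ∀ x, HasDerivAt Real.smoothTransition (deriv Real.smoothTransition x) x := fun x =>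
    (((Real.smoothTransition.contDiff (n := 1)).differentiable one_ne_zero) x).hasDerivAt
  have h1 : HasDerivAt (fun r : ℝ => Real.smoothTransition (r - 1))
      (deriv Real.smoothTransition (r - 1)) r :=
    HasDerivAt.comp_sub_const r 1 (hS (r - 1))
  have h2 : HasDerivAt (fun r : ℝ => Real.smoothTransition (2 - r / R))
      (deriv Real.smoothTransition (2 - r/R) * (-(1/R))) r :=
    HasDerivAt.comp (h₂ := Real.smoothTransition) (h := fun r : ℝ => 2 - r / R) r (hS (2 - r/R))
      (((hasDerivAt_id r).div_const R).const_sub 2)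
  exact h1.mul h2

lemma cutoff_nonneg (R r : ℝ) : 0 ≤ cutoff R r :=
  mul_nonneg (Real.smoothTransition.nonneg _) (Real.smoothTransition.nonneg _)

lemma cutoff_le_one (R r : ℝ) : cutoff R r ≤ 1 :=
  mul_le_one₀ (Real.smoothTransition.le_one _) (Real.smoothTransition.nonneg _)
    (Real.smoothTransition.le_one _)

lemma cutoff_zero_left {R r : ℝ} (h : r ≤ 1) : cutoff R r = 0 := by
  rw [cutoff, Real.smoothTransition.zero_of_nonpos (by linarith), zero_mul]

lemma cutoff_zero_right {R r : ℝ} (hR : 0 < R) (h : 2 * R ≤ r) : cutoff R r = 0 := by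
  have : 2 ≤ r / R := by rwa [le_div_iff₀ hR]
  rw [cutoff, Real.smoothTransition.zero_of_nonpos (x := 2 - r / R) (by linarith), mul_zero]

lemma cutoff_mid {R r : ℝ} (hR : 0 < R) (h : 2 ≤ r) (h' : r ≤ R) :
    cutoff R r = 1 ∧ cutoffD R r = 0 := by
  have : r / R ≤ 1 := by rwa [div_le_one hR]
  constructor
  · rw [cutoff, Real.smoothTransition.one_of_one_le (by linarith),
      Real.smoothTransition.one_of_one_le (by linarith), mul_one]
  · rw [cutoffD, S_deriv_zero (by linarith), S_deriv_zero (by linarith)]; simp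

lemma cutoffD_left {M : ℝ} (hM : ∀ x, |deriv Real.smoothTransition x| ≤ M)
    {R r : ℝ} (hR : 2 ≤ R) (h : 1 ≤ r) (h' : r ≤ 2) : |r * cutoffD R r| ≤ 2 * M := by
  have : r / R ≤ 1 := by rw [div_le_one (by linarith)]; linarith
  rw [cutoffD, S_deriv_zero (x := 2 - r / R) (by linarith),
    Real.smoothTransition.one_of_one_le (x := 2 - r / R) (by linarith)]
  simp only [mul_one, zero_mul, mul_zero, add_zero, abs_mul]
  rw [abs_of_pos (by linarith : (0:ℝ) < r)]
  exact mul_le_mul h' (hM _) (abs_nonneg _) (by norm_num)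

lemma cutoffD_right {M : ℝ} (hM : ∀ x, |deriv Real.smoothTransition x| ≤ M)
    {R r : ℝ} (hR : 2 ≤ R) (h : R ≤ r) (h' : r ≤ 2 * R) : |r * cutoffD R r| ≤ 2 * M := by
  have h2 : r / R ≤ 2 := by rw [div_le_iff₀ (by linarith)]; linarith
  have h0 : 0 ≤ r / R := by apply div_nonneg <;> linarith
  rw [cutoffD, S_deriv_zero (x := r - 1) (by linarith),
    Real.smoothTransition.one_of_one_le (x := r - 1) (by linarith)]
  have : r * (0 * Real.smoothTransition (2 - r / R)
      + 1 * (deriv Real.smoothTransition (2 - r / R) * -(1 / R)))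
      = -((r / R) * deriv Real.smoothTransition (2 - r / R)) := by ring
  rw [this, abs_neg, abs_mul, abs_of_nonneg h0]
  exact mul_le_mul h2 (hM _) (abs_nonneg _) (by norm_num)

/-- the test function -/
noncomputable def testf (n : ℕ) (ρ : ℝ → ℝ) (R r : ℝ) : ℝ :=
  cutoff R r * √(r / (ρ r) ^ (n - 1))

lemma testf_zero {n : ℕ} {ρ : ℝ → ℝ} {R r : ℝ} (hR : 0 < R) (h : r ∉ Ioo 1 (2 * R)) :
    testf n ρ R r = 0 := by
  have : cutoff R r = 0 := by
    by_cases h1 : r ≤ 1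
    · exact cutoff_zero_left h1
    · exact cutoff_zero_right hR (by by_contra h2; exact h ⟨by linarith, by linarith⟩)
  simp [testf, this]

lemma testf_nonneg (n : ℕ) (ρ : ℝ → ℝ) (R r : ℝ) : 0 ≤ testf n ρ R r :=
  mul_nonneg (cutoff_nonneg _ _) (Real.sqrt_nonneg _)

lemma testf_deriv_zero {n : ℕ} {ρ : ℝ → ℝ} {R r : ℝ} (hR : 0 < R) (h : r ∉ Ioo 1 (2 * R)) :
    deriv (testf n ρ R) r = 0 := by
  apply IsLocalMin.deriv_eq_zero
  refine Filter.Eventually.of_forall fun y => ?_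
  rw [testf_zero hR h]; exact testf_nonneg _ _ _ _

lemma testf_contDiff {n : ℕ} {ρ : ℝ → ℝ} (hρ : ContDiff ℝ 1 ρ) (hρpos : ∀ r > (0 : ℝ), 0 < ρ r)
    {R : ℝ} (hR : 0 < R) : ContDiff ℝ 1 (testf n ρ R) := by
  rw [contDiff_iff_contDiffAt]
  intro r
  by_cases hr : 0 < r
  · have hp := hρpos r hr
    unfold testf
    apply (cutoff_contDiff R).contDiffAt.mul
    apply ContDiffAt.sqrt
    · exact contDiffAt_id.div (hρ.contDiffAt.pow _) (by positivity)
    · positivity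
  · have : testf n ρ R =ᶠ[nhds r] fun _ => 0 := by
      filter_upwards [Iio_mem_nhds (show r < 1 by linarith)] with x hx
      exact testf_zero hR (fun h => lt_asymm h.1 hx)
    exact contDiffAt_const.congr_of_eventuallyEq this

lemma testf_tsupport {n : ℕ} {ρ : ℝ → ℝ} {R : ℝ} (hR : 0 < R) :
    tsupport (testf n ρ R) ⊆ Icc 1 (2 * R) := by
  apply closure_minimal _ isClosed_Icc
  intro r hr
  by_contra h
  exact hr (testf_zero hR (fun h' => h (Ioo_subset_Icc_self h')))

lemma testf_compact {n : ℕ} {ρ : ℝ → ℝ} {R : ℝ} (hR : 0 < R) :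
    HasCompactSupport (testf n ρ R) :=
  isCompact_Icc.of_isClosed_subset (isClosed_tsupport _) (testf_tsupport hR)

lemma testf_deriv {n : ℕ} (hn : 3 ≤ n) {ρ : ℝ → ℝ} (hρ : ContDiff ℝ 1 ρ)
    (hρpos : ∀ r > (0 : ℝ), 0 < ρ r) {R r : ℝ} (hr : 0 < r) :
    deriv (testf n ρ R) r = √(r / (ρ r) ^ (n - 1)) / r *
      (cutoff R r / 2 + r * cutoffD R r
        - ((n:ℝ) - 1) / 2 * cutoff R r * (r * deriv ρ r / ρ r)) := by
  have hp := hρpos r hr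
  obtain ⟨k, rfl⟩ := Nat.exists_eq_add_of_le' hn
  have hd : HasDerivAt ρ (deriv ρ r) r := ((hρ.differentiable one_ne_zero) r).hasDerivAt
  have hq : 0 < r / (ρ r) ^ (k + 3 - 1) := by positivity
  have h1 := (((hasDerivAt_id r).div (hd.pow (k + 3 - 1)) (by positivity : (ρ r) ^ (k+3-1) ≠ 0))).sqrt
    (by simpa using hq.ne')
  have h2 := (cutoff_hasDerivAt R r).mul h1
  have h3 : deriv (testf (k + 3) ρ R) r = _ := h2.deriv
  rw [h3]
  simp only [id, Pi.div_apply, Pi.pow_apply]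
  set g := √(r / (ρ r) ^ (k + 3 - 1)) with hg
  have hg0 : 0 < g := Real.sqrt_pos.2 hq
  have hgg : g ^ 2 = r / (ρ r) ^ (k + 3 - 1) := Real.sq_sqrt hq.le
  have e1 : k + 3 - 1 = k + 2 := by omega
  have e2 : k + 2 - 1 = k + 1 := by omega
  rw [e1] at hgg ⊢
  rw [e2]
  push_cast
  have hr' : r = g ^ 2 * (ρ r) ^ (k + 2) := by rw [hgg]; field_simp
  have key : (1 * ρ r ^ (k + 2) - r * ((↑k + 2) * ρ r ^ (k + 1) * deriv ρ r)) / (ρ r ^ (k + 2)) ^ 2 / (2 * g)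
      = g / r * (1 / 2 - ((k:ℝ) + 2) / 2 * (r * deriv ρ r / ρ r)) := by
    have : g / r = 1 / (g * ρ r ^ (k+2)) := by
      rw [div_eq_div_iff hr.ne' (by positivity)]; linarith [hr', sq g, (by ring : g * (g * ρ r ^ (k+2)) = g ^ 2 * ρ r ^ (k+2))]
    rw [this]
    field_simp
    ring
  rw [key]
  field_simp
  ring


/-- the quadratic form integrand -/
noncomputable def stabF (n : ℕ) (a c : ℝ) (ρ f : ℝ → ℝ) (r : ℝ) : ℝ :=
  (deriv f r) ^ 2 * (ρ r) ^ (n - 1)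
        + a * ((n : ℝ) - 1) * ((n : ℝ) - 2) * (deriv ρ r) ^ 2 * (ρ r) ^ (n - 3) * (f r) ^ 2
        + 4 * a * ((n : ℝ) - 1) * (deriv ρ r) * (ρ r) ^ (n - 2) * (f r) * (deriv f r)
        + a * c * (ρ r) ^ (n - 3) * (f r) ^ 2

noncomputable def brack (N a x y v : ℝ) : ℝ :=
  (x / 2 + y - (N - 1) / 2 * x * v) ^ 2 + a * (N - 1) * (N - 2) * (v * x) ^ 2
    + 4 * a * (N - 1) * v * x * (x / 2 + y - (N - 1) / 2 * x * v)

lemma stabF_testf {n : ℕ} (hn : 3 ≤ n) (a c : ℝ) {ρ : ℝ → ℝ} (hρ : ContDiff ℝ 1 ρ)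
    (hρpos : ∀ r > (0 : ℝ), 0 < ρ r) {R r : ℝ} (hr : 0 < r) :
    stabF n a c ρ (testf n ρ R) r =
      r⁻¹ * brack n a (cutoff R r) (r * cutoffD R r) (r * deriv ρ r / ρ r)
        + a * c * (cutoff R r) ^ 2 * (r * ((ρ r)⁻¹) ^ 2) := by
  have hp := hρpos r hr
  unfold stabF brack
  rw [testf_deriv hn hρ hρpos hr, testf]
  obtain ⟨k, rfl⟩ := Nat.exists_eq_add_of_le' hn
  have hq : 0 < r / (ρ r) ^ (k + 3 - 1) := by positivity
  have e1 : k + 3 - 1 = k + 2 := by omega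
  have e2 : k + 3 - 2 = k + 1 := by omega
  have e3 : k + 3 - 3 = k := by omega
  rw [e1] at hq
  rw [e1, e2, e3]
  set g := √(r / (ρ r) ^ (k + 2)) with hg
  have hgg : g ^ 2 = r / (ρ r) ^ (k + 2) := Real.sq_sqrt hq.le
  set x := cutoff R r
  set y := r * cutoffD R r
  set N : ℝ := ((k + 3 : ℕ) : ℝ)
  set d := deriv ρ r
  set z := x / 2 + y - (N - 1) / 2 * x * (r * d / ρ r)
  have : (g / r * z) ^ 2 * ρ r ^ (k + 2) + a * (N - 1) * (N - 2) * d ^ 2 * ρ r ^ k * (x * g) ^ 2 +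
      4 * a * (N - 1) * d * ρ r ^ (k + 1) * (x * g) * (g / r * z) + a * c * ρ r ^ k * (x * g) ^ 2
      = g ^ 2 * (z ^ 2 / r ^ 2 * ρ r ^ (k + 2) + a * (N - 1) * (N - 2) * d ^ 2 * ρ r ^ k * x ^ 2 +
      4 * a * (N - 1) * d * ρ r ^ (k + 1) * x * z / r + a * c * ρ r ^ k * x ^ 2) := by
    ring
  rw [this, hgg]
  have hN : z = z := rfl
  clear_value z
  field_simp
  ring

lemma brack_le {N a x y v : ℝ} (hN : 3 ≤ N) (ha : (N - 1) / (4 * N) < a) :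
    brack N a x y v ≤
      (1 + ((4 * a - 1) * (N - 1)) ^ 2 / (4 * ((N - 1) * (a * N - (N - 1) / 4)))) * (x / 2 + y) ^ 2 := by
  rw [div_lt_iff₀ (by linarith)] at ha
  have hk : 0 < (N - 1) * (a * N - (N - 1) / 4) := mul_pos (by linarith) (by linarith)
  set μ := (4 * a - 1) * (N - 1) with hμ
  set κ := (N - 1) * (a * N - (N - 1) / 4) with hκ
  have e : brack N a x y v = (x / 2 + y) ^ 2 + μ * (v * x) * (x / 2 + y) - κ * (v * x) ^ 2 := by
    rw [brack, hμ, hκ]; ring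
  rw [e]
  have : (1 + μ ^ 2 / (4 * κ)) * (x / 2 + y) ^ 2 -
    ((x / 2 + y) ^ 2 + μ * (v * x) * (x / 2 + y) - κ * (v * x) ^ 2)
     = (μ * (x / 2 + y) - 2 * κ * (v * x)) ^ 2 / (4 * κ) := by
    field_simp; ring
  have h2 : 0 ≤ (μ * (x / 2 + y) - 2 * κ * (v * x)) ^ 2 / (4 * κ) := by positivity
  linarith

lemma brack_mid {N a : ℝ} (hN : 3 ≤ N) (ha : (N - 1) / (4 * N) < a) :
    ∃ δ s : ℝ, 0 < δ ∧ 0 ≤ s ∧ ∀ v, brack N a 1 0 v ≤ -δ - s * (v - N / (2 * N - 2)) := by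
  rw [div_lt_iff₀ (by linarith)] at ha
  have hk : 0 < (N - 1) * (a * N - (N - 1) / 4) := mul_pos (by linarith) (by linarith)
  refine ⟨(N - 2) ^ 2 * (a * N / (4 * (N - 1)) - 1 / 16),
    a * (N ^ 2 - 2 * N + 2) - (N - 1) * (N - 2) / 4, ?_, ?_, fun v => ?_⟩
  · apply mul_pos
    · have : 0 < N - 2 := by linarith
      positivity
    · have : 1 / 16 < a * N / (4 * (N - 1)) := by
        rw [lt_div_iff₀ (by linarith)]; linarith
      linarith
  · have h1 : (N - 1) * (N ^ 2 - 2 * N + 2) ≤ (a * (4 * N)) * (N ^ 2 - 2 * N + 2) :=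
      mul_le_mul_of_nonneg_right ha.le (by nlinarith)
    have : 0 ≤ 4 * N * (a * (N ^ 2 - 2 * N + 2) - (N - 1) * (N - 2) / 4) := by
      nlinarith
    exact nonneg_of_mul_nonneg_right this (by linarith)
  · have h1 : N - 1 ≠ 0 := by linarith
    have h2 : 2 * N - 2 = 2 * (N - 1) := by ring
    have e : brack N a 1 0 v = -((N - 2) ^ 2 * (a * N / (4 * (N - 1)) - 1 / 16))
      - (a * (N ^ 2 - 2 * N + 2) - (N - 1) * (N - 2) / 4) * (v - N / (2 * N - 2))
      - ((N - 1) * (a * N - (N - 1) / 4)) * (v - N / (2 * N - 2)) ^ 2 := by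
      rw [brack, h2]; field_simp; ring
    rw [e]
    have : 0 ≤ ((N - 1) * (a * N - (N - 1) / 4)) * (v - N / (2 * N - 2)) ^ 2 := by positivity
    linarith


lemma key_ineq (n : ℕ) (hn : 3 ≤ n) (c : ℝ)
    (ρ : ℝ → ℝ) (hρ : ContDiff ℝ 1 ρ) (hρpos : ∀ r > (0 : ℝ), 0 < ρ r)
    (a : ℝ) (ha : ((n : ℝ) - 1) / (4 * (n : ℝ)) < a)
    (hstab : ∀ f : ℝ → ℝ, (∃ K, LipschitzWith K f) → HasCompactSupport f →
      tsupport f ⊆ Set.Ioi (0 : ℝ) →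
      0 ≤ ∫ r in Set.Ioi (0 : ℝ), stabF n a c ρ f r) :
    ∃ C δ s : ℝ, 0 < δ ∧ 0 ≤ s ∧ ∀ R : ℝ, 2 ≤ R →
      0 ≤ C - δ * Real.log R
        + s * ((n : ℝ) / (2 * (n : ℝ) - 2) * Real.log R - Real.log (ρ R))
        + a * max c 0 * ∫ r in (1 : ℝ)..(2 * R), r * ((ρ r)⁻¹) ^ 2 := by
  have hN : (3 : ℝ) ≤ n := by exact_mod_cast hn
  have ha0 : 0 < a := lt_of_le_of_lt (div_nonneg (by linarith) (by linarith)) ha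
  obtain ⟨M, hM0, hM⟩ := S_deriv_bdd
  obtain ⟨δ, s, hδ, hs, hmid⟩ := brack_mid hN ha
  set v1 : ℝ := (n : ℝ) / (2 * (n : ℝ) - 2) with hv1
  obtain ⟨A, hA0, hA⟩ : ∃ A : ℝ, 0 ≤ A ∧ ∀ x y v, brack n a x y v ≤ A * (x / 2 + y) ^ 2 := by
    refine ⟨_, ?_, fun x y v => brack_le hN ha⟩
    have h := ha
    rw [div_lt_iff₀ (by linarith)] at h
    have hk : 0 < ((n : ℝ) - 1) * (a * n - ((n : ℝ) - 1) / 4) :=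
      mul_pos (by linarith) (by linarith)
    positivity
  set D : ℝ := A * (1 + 2 * M) ^ 2 with hD
  have hD0 : 0 ≤ D := by positivity
  have hB0 : 0 ≤ a * max c 0 := mul_nonneg ha0.le (le_max_right _ _)
  set B := a * max c 0 with hB
  set J : ℝ → ℝ := fun r => r * ((ρ r)⁻¹) ^ 2 with hJ
  have hJc : ContinuousOn J (Ioi 0) := by
    apply continuousOn_id.mul
    exact (hρ.continuous.continuousOn.inv₀ (fun x hx => (hρpos x hx).ne')).pow 2
  have hJi : ∀ p q : ℝ, 0 < p → 0 < q → IntervalIntegrable J volume p q := fun p q hp hq =>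
    (hJc.mono (fun x hx => lt_of_lt_of_le (lt_min hp hq) hx.1)).intervalIntegrable
  refine ⟨2 * D + (δ - s * v1) * Real.log 2 + s * Real.log (ρ 2), δ, s, hδ, hs, fun R hR => ?_⟩
  have hR0 : 0 < R := by linarith
  set f := testf n ρ R with hf
  have hfc : ContDiff ℝ 1 f := testf_contDiff hρ hρpos hR0
  have h0 := hstab f (hfc.lipschitzWith_of_hasCompactSupport (testf_compact hR0) one_ne_zero)
    (testf_compact hR0)
    ((testf_tsupport hR0).trans (fun x hx => lt_of_lt_of_le zero_lt_one hx.1))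
  set F : ℝ → ℝ := stabF n a c ρ f with hF
  have hFc : Continuous F := by
    have h1 := hfc.continuous_deriv le_rfl
    have h2 := hρ.continuous_deriv le_rfl
    have h3 := hfc.continuous
    have h4 := hρ.continuous
    rw [hF]; unfold stabF
    fun_prop
  have hFi : ∀ p q : ℝ, IntervalIntegrable F volume p q := fun p q => hFc.intervalIntegrable p q
  have hF0 : ∫ r in Ioi (0:ℝ), F r = ∫ r in (1:ℝ)..(2 * R), F r := by
    rw [intervalIntegral.integral_of_le (by linarith)]
    have hsub : Ioc 1 (2 * R) ⊆ Ioi (0:ℝ) := fun x hx => lt_trans zero_lt_one hx.1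
    refine setIntegral_eq_of_subset_of_forall_sdiff_eq_zero measurableSet_Ioi hsub ?_
    intro x hx
    have hx' : x ∉ Ioo 1 (2 * R) := fun h => hx.2 (Ioo_subset_Ioc_self h)
    simp only [hF, stabF, hf, testf_zero hR0 hx', testf_deriv_zero hR0 hx']
    simp
  rw [hF0, ← intervalIntegral.integral_add_adjacent_intervals (hFi 1 2) (hFi 2 (2 * R)),
    ← intervalIntegral.integral_add_adjacent_intervals (hFi 2 R) (hFi R (2 * R))] at h0
  have hcut : ∀ r, 0 < r → a * c * (cutoff R r) ^ 2 * J r ≤ B * J r := by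
    intro r hr
    have hp := hρpos r hr
    apply mul_le_mul_of_nonneg_right
    · have h1 : (cutoff R r) ^ 2 ≤ 1 := pow_le_one₀ (cutoff_nonneg _ _) (cutoff_le_one _ _)
      calc a * c * (cutoff R r) ^ 2 ≤ B * (cutoff R r) ^ 2 :=
            mul_le_mul_of_nonneg_right (mul_le_mul_of_nonneg_left (le_max_left _ _) ha0.le)
              (sq_nonneg _)
        _ ≤ B * 1 := mul_le_mul_of_nonneg_left h1 hB0
        _ = B := mul_one _
    · simp only [hJ]; positivity
  have hbr : ∀ r, |r * cutoffD R r| ≤ 2 * M → ∀ v,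
      brack n a (cutoff R r) (r * cutoffD R r) v ≤ D := by
    intro r hr v
    refine (hA _ _ _).trans (mul_le_mul_of_nonneg_left ?_ hA0)
    rw [abs_le] at hr
    apply sq_le_sq'
    · linarith [cutoff_nonneg R r]
    · linarith [cutoff_le_one R r]
  have i1 : ∫ r in (1:ℝ)..2, F r ≤ ∫ r in (1:ℝ)..2, (D + B * J r) := by
    apply intervalIntegral.integral_mono_on (by norm_num) (hFi _ _)
    · exact intervalIntegrable_const.add ((hJi 1 2 (by norm_num) (by norm_num)).const_mul B)
    · intro r hr
      have hr0 : 0 < r := by linarith [hr.1]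
      rw [hF, stabF_testf hn a c hρ hρpos hr0]
      refine add_le_add ?_ (hcut r hr0)
      calc r⁻¹ * brack n a (cutoff R r) (r * cutoffD R r) (r * deriv ρ r / ρ r)
          ≤ r⁻¹ * D := mul_le_mul_of_nonneg_left (hbr r (cutoffD_left hM hR hr.1 hr.2) _)
            (by positivity)
        _ ≤ 1 * D := mul_le_mul_of_nonneg_right (inv_le_one_of_one_le₀ hr.1) hD0
        _ = D := one_mul _
  have i3 : ∫ r in R..(2 * R), F r ≤ ∫ r in R..(2 * R), (R⁻¹ * D + B * J r) := by
    apply intervalIntegral.integral_mono_on (by linarith) (hFi _ _)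
    · exact intervalIntegrable_const.add ((hJi R (2 * R) hR0 (by linarith)).const_mul B)
    · intro r hr
      have hr0 : 0 < r := by linarith [hr.1]
      rw [hF, stabF_testf hn a c hρ hρpos hr0]
      refine add_le_add ?_ (hcut r hr0)
      calc r⁻¹ * brack n a (cutoff R r) (r * cutoffD R r) (r * deriv ρ r / ρ r)
          ≤ r⁻¹ * D := mul_le_mul_of_nonneg_left (hbr r (cutoffD_right hM hR hr.1 hr.2) _)
            (by positivity)
        _ ≤ R⁻¹ * D := mul_le_mul_of_nonneg_right (inv_anti₀ hR0 hr.1) hD0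
  have hposI : ∀ x ∈ uIcc 2 R, (0:ℝ) < x := by
    intro x hx
    rw [uIcc_of_le hR] at hx
    linarith [hx.1]
  have j1 : IntervalIntegrable (fun r : ℝ => (-δ + s * v1) * r⁻¹) volume 2 R := by
    apply ContinuousOn.intervalIntegrable
    exact continuousOn_const.mul (continuousOn_id.inv₀ (fun x hx => (hposI x hx).ne'))
  have j2 : IntervalIntegrable (fun r : ℝ => deriv ρ r / ρ r) volume 2 R := by
    apply ContinuousOn.intervalIntegrable
    exact (hρ.continuous_deriv le_rfl).continuousOn.div hρ.continuous.continuousOn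
      (fun x hx => (hρpos x (hposI x hx)).ne')
  have j3 := (hJi 2 R (by norm_num) hR0).const_mul B
  have i2 : ∫ r in (2:ℝ)..R, F r ≤
      ∫ r in (2:ℝ)..R, ((-δ + s * v1) * r⁻¹ - s * (deriv ρ r / ρ r) + B * J r) := by
    apply intervalIntegral.integral_mono_on hR (hFi _ _)
    · exact (j1.sub (j2.const_mul s)).add j3
    · intro r hr
      have hr0 : 0 < r := by linarith [hr.1]
      rw [hF, stabF_testf hn a c hρ hρpos hr0]
      refine add_le_add ?_ (hcut r hr0)
      obtain ⟨h1, h2⟩ := cutoff_mid hR0 hr.1 hr.2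
      rw [h1, h2, mul_zero]
      have hp := hρpos r hr0
      calc r⁻¹ * brack n a 1 0 (r * deriv ρ r / ρ r)
          ≤ r⁻¹ * (-δ - s * (r * deriv ρ r / ρ r - v1)) :=
            mul_le_mul_of_nonneg_left (hmid _) (by positivity)
        _ = (-δ + s * v1) * r⁻¹ - s * (deriv ρ r / ρ r) := by field_simp; ring
  have k1 : ∫ r in (1:ℝ)..2, (D + B * J r) = D + B * ∫ r in (1:ℝ)..2, J r := by
    rw [intervalIntegral.integral_add intervalIntegrable_const
      ((hJi 1 2 (by norm_num) (by norm_num)).const_mul B),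
      intervalIntegral.integral_const, intervalIntegral.integral_const_mul, smul_eq_mul]
    ring
  have k3 : ∫ r in R..(2 * R), (R⁻¹ * D + B * J r) = D + B * ∫ r in R..(2 * R), J r := by
    rw [intervalIntegral.integral_add intervalIntegrable_const
      ((hJi R (2 * R) hR0 (by linarith)).const_mul B),
      intervalIntegral.integral_const, intervalIntegral.integral_const_mul, smul_eq_mul]
    field_simp
    ring
  have kl : ∫ r in (2:ℝ)..R, deriv ρ r / ρ r = Real.log (ρ R) - Real.log (ρ 2) := by
    apply intervalIntegral.integral_eq_sub_of_hasDerivAt (f := fun r => Real.log (ρ r)) _ j2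
    intro x hx
    exact (((hρ.differentiable one_ne_zero) x).hasDerivAt).log (hρpos x (hposI x hx)).ne'
  have k2 : ∫ r in (2:ℝ)..R, ((-δ + s * v1) * r⁻¹ - s * (deriv ρ r / ρ r) + B * J r)
      = (-δ + s * v1) * (Real.log R - Real.log 2) - s * (Real.log (ρ R) - Real.log (ρ 2))
        + B * ∫ r in (2:ℝ)..R, J r := by
    rw [intervalIntegral.integral_add (j1.sub (j2.const_mul s)) j3,
      intervalIntegral.integral_sub j1 (j2.const_mul s),
      intervalIntegral.integral_const_mul, intervalIntegral.integral_const_mul,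
      intervalIntegral.integral_const_mul, kl, integral_inv_of_pos (by norm_num) hR0,
      Real.log_div hR0.ne' (by norm_num)]
  have kJ : ∫ r in (1:ℝ)..(2 * R), J r = (∫ r in (1:ℝ)..2, J r) + ((∫ r in (2:ℝ)..R, J r)
      + ∫ r in R..(2 * R), J r) := by
    rw [intervalIntegral.integral_add_adjacent_intervals (hJi 2 R (by norm_num) hR0)
      (hJi R (2 * R) hR0 (by linarith)),
      intervalIntegral.integral_add_adjacent_intervals (hJi 1 2 (by norm_num) (by norm_num))
      (hJi 2 (2 * R) (by norm_num) (by linarith))]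
  rw [k1] at i1; rw [k2] at i2; rw [k3] at i3
  rw [kJ]
  linarith

lemma part_two (v1 C δ s α : ℝ) (ρ : ℝ → ℝ) (hρpos : ∀ r > (0 : ℝ), 0 < ρ r)
    (hδ : 0 < δ) (hs : 0 ≤ s)
    (hα2 : ∀ γ < α, ¬ Tendsto (fun r : ℝ => ρ r * r ^ (-γ)) atTop (nhds 0))
    (h : ∀ R : ℝ, 2 ≤ R → 0 ≤ C - δ * Real.log R
        + s * (v1 * Real.log R - Real.log (ρ R))) : α < v1 := by
  by_contra hcon
  push Not at hcon
  obtain ⟨η, hη, hsη⟩ : ∃ η : ℝ, 0 < η ∧ s * η ≤ δ / 2 := by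
    refine ⟨δ / (2 * (s + 1)), by positivity, ?_⟩
    rw [mul_div_assoc', div_le_div_iff₀ (by positivity) (by norm_num)]
    nlinarith
  apply hα2 (v1 - η) (by linarith)
  rw [Metric.tendsto_atTop]
  intro ε hε
  obtain ⟨R0, hR0⟩ := (Real.tendsto_log_atTop.eventually_gt_atTop
    ((C - s * Real.log ε) * 2 / δ)).exists_forall_of_atTop
  refine ⟨max R0 2, fun R hR => ?_⟩
  have hR2 : 2 ≤ R := (le_max_right _ _).trans hR
  have hRp : 0 < R := by linarith
  have hp := hρpos R hRp
  have hq : 0 < R ^ (-(v1 - η)) := Real.rpow_pos_of_pos hRp _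
  rw [Real.dist_eq, sub_zero, abs_of_pos (mul_pos hp hq)]
  by_contra hlt
  push Not at hlt
  have h1 := Real.log_le_log hε hlt
  rw [Real.log_mul hp.ne' hq.ne', Real.log_rpow hRp] at h1
  have h2 := hR0 R ((le_max_left _ _).trans hR)
  rw [div_lt_iff₀ hδ] at h2
  have h3 := h R hR2
  have hl : 0 ≤ Real.log R := Real.log_nonneg (by linarith)
  have h4 : s * (v1 * Real.log R - Real.log (ρ R)) ≤ s * (η * Real.log R - Real.log ε) :=
    mul_le_mul_of_nonneg_left (by linarith) hs
  have h5 : s * η * Real.log R ≤ δ / 2 * Real.log R := mul_le_mul_of_nonneg_right hsη hl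
  linarith

lemma part_one (v1 C δ s B : ℝ) (ρ : ℝ → ℝ) (hρ : ContDiff ℝ 1 ρ)
    (hρpos : ∀ r > (0 : ℝ), 0 < ρ r)
    (hδ : 0 < δ) (hs : 0 ≤ s) (hB : 0 ≤ B) (hv1 : v1 ≤ 1)
    (h : ∀ R : ℝ, 2 ≤ R → 0 ≤ C - δ * Real.log R
        + s * (v1 * Real.log R - Real.log (ρ R))
        + B * ∫ r in (1 : ℝ)..(2 * R), r * ((ρ r)⁻¹) ^ 2) :
    ∃ ε : ℝ, 0 < ε ∧ ∀ᶠ R : ℝ in atTop,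
      ε ≤ (Real.log R)⁻¹ * ∫ r in (1 : ℝ)..R, r * ((ρ r)⁻¹) ^ 2 := by
  set J : ℝ → ℝ := fun r => r * ((ρ r)⁻¹) ^ 2 with hJ
  have hJc : ContinuousOn J (Ioi 0) := by
    apply continuousOn_id.mul
    exact (hρ.continuous.continuousOn.inv₀ (fun x hx => (hρpos x hx).ne')).pow 2
  have hJi : ∀ p q : ℝ, 0 < p → 0 < q → IntervalIntegrable J volume p q := fun p q hp hq =>
    (hJc.mono (fun x hx => lt_of_lt_of_le (lt_min hp hq) hx.1)).intervalIntegrable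
  have hJ0 : ∀ p q : ℝ, 0 < p → p ≤ q → 0 ≤ ∫ r in p..q, J r := by
    intro p q hp hpq
    apply intervalIntegral.integral_nonneg hpq
    intro u hu
    have : 0 < u := lt_of_lt_of_le hp hu.1
    simp only [hJ]; positivity
  obtain ⟨ε, hε, hε4, hεB⟩ : ∃ ε : ℝ, 0 < ε ∧ ε ≤ 1 / 4 ∧ B * ε ≤ δ / 4 := by
    refine ⟨min (1 / 4) (δ / (4 * (B + 1))), by positivity, min_le_left _ _, ?_⟩
    refine (mul_le_mul_of_nonneg_left (min_le_right _ _) hB).trans ?_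
    rw [mul_div_assoc', div_le_div_iff₀ (by positivity) (by norm_num)]
    nlinarith
  refine ⟨ε, hε, ?_⟩
  filter_upwards [Real.tendsto_log_atTop.eventually_gt_atTop (4 * Real.log 2),
    Real.tendsto_log_atTop.eventually_gt_atTop (C * 4 / δ), eventually_ge_atTop 16]
    with R hR1 hR2 hR16
  have hRp : 0 < R := by linarith
  have hlog2 : 0 < Real.log 2 := Real.log_pos (by norm_num)
  have hl : 0 < Real.log R := by linarith
  rw [inv_mul_eq_div, le_div_iff₀ hl]
  by_contra hlt
  push Not at hlt
  have hsq : √R * √R = R := Real.mul_self_sqrt hRp.le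
  have hs4 : 4 ≤ √R := Real.le_sqrt_of_sq_le (by linarith)
  have hsR : √R ≤ R / 2 := by nlinarith
  have hlsq : Real.log √R = Real.log R / 2 := Real.log_sqrt hRp.le
  obtain ⟨r, hr, hrρ⟩ : ∃ r ∈ Icc √R (R / 2), r ≤ ρ r := by
    by_contra hno
    push Not at hno
    have i1 : ∫ r in √R..(R / 2), r⁻¹ ≤ ∫ r in √R..(R / 2), J r := by
      apply intervalIntegral.integral_mono_on hsR
      · apply ContinuousOn.intervalIntegrable
        apply continuousOn_id.inv₀
        intro x hx
        rw [uIcc_of_le hsR] at hx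
        have : 0 < x := by linarith [hx.1]
        exact this.ne'
      · exact hJi _ _ (by linarith) (by linarith)
      · intro x hx
        have hx0 : 0 < x := by linarith [hx.1]
        have hp := hρpos x hx0
        have h1 : x⁻¹ ≤ (ρ x)⁻¹ := inv_anti₀ hp (hno x hx).le
        calc x⁻¹ = x * (x⁻¹) ^ 2 := by field_simp
          _ ≤ x * ((ρ x)⁻¹) ^ 2 := by gcongr
    rw [integral_inv_of_pos (by linarith) (by linarith), Real.log_div (by positivity) (by positivity),
      Real.log_div (by positivity) (by norm_num), hlsq] at i1
    have e1 := intervalIntegral.integral_add_adjacent_intervals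
      (hJi 1 √R (by norm_num) (by linarith)) (hJi √R (R / 2) (by linarith) (by linarith))
    have e2 := intervalIntegral.integral_add_adjacent_intervals
      (hJi 1 (R / 2) (by norm_num) (by linarith)) (hJi (R / 2) R (by linarith) (by linarith))
    have n1 := hJ0 1 √R (by norm_num) (by linarith)
    have n2 := hJ0 (R / 2) R (by linarith) (by linarith)
    have : ε * Real.log R ≤ 1 / 4 * Real.log R := mul_le_mul_of_nonneg_right hε4 hl.le
    linarith
  have hr0 : 0 < r := by linarith [hr.1]
  have hk := h r (by linarith [hr.1])
  have e2 := intervalIntegral.integral_add_adjacent_intervals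
      (hJi 1 (2 * r) (by norm_num) (by linarith)) (hJi (2 * r) R (by linarith) (by linarith))
  have n2 := hJ0 (2 * r) R (by linarith) (by linarith [hr.2])
  have g1 : B * ∫ r in (1:ℝ)..(2 * r), J r ≤ B * (ε * Real.log R) :=
    mul_le_mul_of_nonneg_left (by linarith) hB
  have g2 : B * ε * Real.log R ≤ δ / 4 * Real.log R := mul_le_mul_of_nonneg_right hεB hl.le
  have l1 : Real.log R / 2 ≤ Real.log r := by
    rw [← hlsq]; exact Real.log_le_log (by linarith) hr.1
  have l2 : Real.log r ≤ Real.log (ρ r) := Real.log_le_log hr0 hrρ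
  have l3 : v1 * Real.log r ≤ 1 * Real.log r := mul_le_mul_of_nonneg_right hv1 (by linarith)
  have l4 : s * (v1 * Real.log r - Real.log (ρ r)) ≤ 0 :=
    mul_nonpos_of_nonneg_of_nonpos hs (by linarith)
  have l5 : δ * (Real.log R / 2) ≤ δ * Real.log r := mul_le_mul_of_nonneg_left l1 hδ.le
  rw [div_lt_iff₀ hδ] at hR2
  linarith

/-- Radial formulation: if the radial stability form is nonnegative for some
`a > (n-1)/(4n)`, then `liminf (log R)⁻¹ ∫_1^R r ρ(r)⁻² dr > 0`; if moreover `c ≤ 0`,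
then the polynomial growth order `α` of `ρ` satisfies `α < n/(2n-2)`. -/
theorem stmt_15 (n : ℕ) (hn : 3 ≤ n) (c α : ℝ)
    (ρ : ℝ → ℝ) (hρ : ContDiff ℝ 1 ρ) (hρpos : ∀ r > (0 : ℝ), 0 < ρ r)
    (hα1 : ∀ γ > α, Tendsto (fun r : ℝ => ρ r * r ^ (-γ)) atTop (nhds 0))
    (hα2 : ∀ γ < α, ¬ Tendsto (fun r : ℝ => ρ r * r ^ (-γ)) atTop (nhds 0))
    (a : ℝ) (ha : ((n : ℝ) - 1) / (4 * (n : ℝ)) < a)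
    (hstab : ∀ f : ℝ → ℝ, (∃ K, LipschitzWith K f) → HasCompactSupport f →
      tsupport f ⊆ Set.Ioi (0 : ℝ) →
      0 ≤ ∫ r in Set.Ioi (0 : ℝ), ((deriv f r) ^ 2 * (ρ r) ^ (n - 1)
        + a * ((n : ℝ) - 1) * ((n : ℝ) - 2) * (deriv ρ r) ^ 2 * (ρ r) ^ (n - 3) * (f r) ^ 2
        + 4 * a * ((n : ℝ) - 1) * (deriv ρ r) * (ρ r) ^ (n - 2) * (f r) * (deriv f r)
        + a * c * (ρ r) ^ (n - 3) * (f r) ^ 2)) :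
    (0 : EReal) < Filter.liminf
        (fun R : ℝ => (((Real.log R)⁻¹ * ∫ r in (1 : ℝ)..R, r * ((ρ r)⁻¹) ^ 2 : ℝ) : EReal))
        atTop ∧
      (c ≤ 0 → α < (n : ℝ) / (2 * (n : ℝ) - 2)) := by
  have hN : (3 : ℝ) ≤ n := by exact_mod_cast hn
  have ha0 : 0 < a := lt_of_le_of_lt (div_nonneg (by linarith) (by linarith)) ha
  obtain ⟨C, δ, s, hδ, hs, hkey⟩ := key_ineq n hn c ρ hρ hρpos a ha hstab
  constructor
  · obtain ⟨ε, hε, hev⟩ := part_one ((n : ℝ) / (2 * (n : ℝ) - 2)) C δ s (a * max c 0) ρ hρ hρpos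
      hδ hs (mul_nonneg ha0.le (le_max_right _ _))
      (by rw [div_le_one (by linarith)]; linarith) hkey
    refine lt_of_lt_of_le (b := (ε : EReal)) (by exact_mod_cast hε) ?_
    apply Filter.le_liminf_of_le
    · isBoundedDefault
    · filter_upwards [hev] with R hR
      exact_mod_cast hR
  · intro hc
    refine part_two _ C δ s α ρ hρpos hδ hs hα2 fun R hR => ?_
    have := hkey R hR
    rw [max_eq_right hc] at this
    simpa using this
end

section
/- Let n ≥ 2 be an integer and a a real number with a > max{1, (n−2)²/(4(n−1))}. Then there exists a Lipschitz function φ : ℝ → ℝ with compact support contained in (0, ∞) such that ∫_0^∞ [ −((8a³+3a²−2a−1)/(4a²))·r^{(na−4a−1)/a}·φ(r)² + ((2a²−a−1)/a)·r^{(na−3a−1)/a}·φ(r)·φ'(r) + r^{(na−2a−1)/a}·φ'(r)² ] dr < 0, where φ' denotes the almost-everywhere derivative of φ. -/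
open MeasureTheory Filter Set

lemma aux_main (s B A w : ℝ) (hw : 0 < w) (hq : s ^ 2 - B * s - A = -(4 * w ^ 2)) :
    ∃ φ : ℝ → ℝ, (∃ K, LipschitzWith K φ) ∧ HasCompactSupport φ ∧
      tsupport φ ⊆ Set.Ioi (0 : ℝ) ∧
      (∫ r in Set.Ioi (0 : ℝ),
        (-A * r ^ (2 * s - 1) * (φ r) ^ 2 + B * r ^ (2 * s) * (φ r) * (deriv φ r)
          + r ^ (2 * s + 1) * (deriv φ r) ^ 2)) < 0 := by
  set R : ℝ := Real.exp (Real.pi / w) with hR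
  have h1R : (1 : ℝ) < R := by
    rw [hR]; exact Real.one_lt_exp_iff.mpr (div_pos Real.pi_pos hw)
  set g : ℝ → ℝ := fun r => r ^ (-s) * Real.sin (w * Real.log r) with hg
  set g' : ℝ → ℝ := fun r => r ^ (-s) / r * (w * Real.cos (w * Real.log r)
    - s * Real.sin (w * Real.log r)) with hg'
  have hgd : ∀ r, 0 < r → HasDerivAt g (g' r) r := by
    intro r hr
    have h1 := Real.hasDerivAt_rpow_const (x := r) (p := -s) (Or.inl hr.ne')
    have h2 := ((Real.hasDerivAt_log hr.ne').const_mul w).sin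
    refine (h1.mul h2).congr_deriv ?_
    rw [Real.rpow_sub_one hr.ne', hg']
    field_simp
    ring
  have hg1 : g 1 = 0 := by simp [hg]
  have hgR : g R = 0 := by
    have : w * (Real.pi / w) = Real.pi := by field_simp
    simp [hg, hR, this]
  have hg'c : ContinuousOn g' (Icc 1 R) := by
    intro r hr
    have hr0 : r ≠ 0 := by linarith [hr.1]
    refine ContinuousAt.continuousWithinAt ?_
    have hl := Real.continuousAt_log hr0
    have hp : ContinuousAt (fun r : ℝ => r ^ (-s)) r := Real.continuousAt_rpow_const _ _ (Or.inl hr0)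
    have hwl : ContinuousAt (fun r : ℝ => w * Real.log r) r := continuousAt_const.mul hl
    have hc : ContinuousAt (fun r : ℝ => Real.cos (w * Real.log r)) r :=
      Real.continuous_cos.continuousAt.comp hwl
    have hs : ContinuousAt (fun r : ℝ => Real.sin (w * Real.log r)) r :=
      Real.continuous_sin.continuousAt.comp hwl
    exact (hp.div continuousAt_id hr0).mul ((continuousAt_const.mul hc).sub (continuousAt_const.mul hs))
  obtain ⟨C, hC⟩ := isCompact_Icc.exists_bound_of_continuousOn hg'c
  have hLip : LipschitzOnWith C.toNNReal g (Icc 1 R) := by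
    refine (convex_Icc 1 R).lipschitzOnWith_of_nnnorm_hasDerivWithin_le
      (fun x hx => (hgd x (by linarith [hx.1])).hasDerivWithinAt) ?_
    intro x hx
    have := hC x hx
    rw [← NNReal.coe_le_coe, coe_nnnorm]
    exact this.trans (Real.le_coe_toNNReal C)
  set φ : ℝ → ℝ := fun r => g (max 1 (min R r)) with hφ
  have hin : ∀ r ∈ Icc 1 R, φ r = g r := by
    intro r hr
    simp only [hφ]
    rw [min_eq_right hr.2, max_eq_right hr.1]
  have hout : ∀ r, r ∉ Icc 1 R → φ r = 0 := by
    intro r hr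
    simp only [hφ]
    rcases lt_or_ge r 1 with h | h
    · rw [min_eq_right (by linarith), max_eq_left h.le, hg1]
    · have h2 : R < r := by
        by_contra h3
        exact hr ⟨h, not_lt.mp h3⟩
      rw [min_eq_left h2.le, max_eq_right h1R.le, hgR]
  have hts : tsupport φ ⊆ Icc 1 R := by
    refine closure_minimal ?_ isClosed_Icc
    intro r hr
    by_contra h
    exact hr (hout r h)
  have hdout : ∀ r, r ∉ Icc 1 R → deriv φ r = 0 := by
    intro r hr
    have : φ =ᶠ[nhds r] fun _ => 0 := by
      filter_upwards [isClosed_Icc.isOpen_compl.mem_nhds hr] with y hy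
      exact hout y hy
    rw [this.deriv_eq]; simp
  have hdin : ∀ r ∈ Ioo 1 R, deriv φ r = g' r := by
    intro r hr
    have : φ =ᶠ[nhds r] g := by
      filter_upwards [Icc_mem_nhds hr.1 hr.2] with y hy
      exact hin y hy
    rw [this.deriv_eq]
    exact (hgd r (by linarith [hr.1])).deriv
  refine ⟨φ, ⟨C.toNNReal, ?_⟩, ?_, ?_, ?_⟩
  · have hm : LipschitzWith 1 (fun r : ℝ => max 1 (min R r)) :=
      (LipschitzWith.id.const_min R).const_max 1
    have := hLip.comp (g := g) (f := fun r : ℝ => max 1 (min R r)) (s := univ) hm.lipschitzOnWith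
      (fun r _ => ⟨le_max_left _ _, max_le h1R.le (min_le_left _ _)⟩)
    rw [mul_one, lipschitzOnWith_univ] at this
    exact this
  · exact HasCompactSupport.of_support_subset_isCompact isCompact_Icc
      ((subset_tsupport φ).trans hts)
  · intro r hr
    have := (hts hr).1
    exact lt_of_lt_of_le one_pos this
  rw [setIntegral_eq_of_subset_of_forall_diff_eq_zero (s := Icc 1 R) measurableSet_Ioi
    (fun r hr => lt_of_lt_of_le one_pos hr.1)
    (fun r hr => by rw [hout r hr.2, hdout r hr.2]; ring)]
  rw [integral_Icc_eq_integral_Ioo]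
  set G' : ℝ → ℝ := fun r => (w ^ 2 * Real.cos (w * Real.log r) ^ 2
    + (B - 2 * s) * w * (Real.sin (w * Real.log r) * Real.cos (w * Real.log r))
    - 4 * w ^ 2 * Real.sin (w * Real.log r) ^ 2) / r with hG'
  set G : ℝ → ℝ := fun r => -(3 * w ^ 2 / 2) * Real.log r
    + 5 * w / 2 * (Real.sin (w * Real.log r) * Real.cos (w * Real.log r))
    + (B - 2 * s) / 2 * (Real.sin (w * Real.log r) * Real.sin (w * Real.log r)) with hG
  have hGd : ∀ r, 0 < r → HasDerivAt G (G' r) r := by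
    intro r hr
    have hl := Real.hasDerivAt_log hr.ne'
    have hS := (hl.const_mul w).sin
    have hK := (hl.const_mul w).cos
    refine (((hl.const_mul (-(3 * w ^ 2 / 2))).add ((hS.mul hK).const_mul (5 * w / 2))).add
      ((hS.mul hS).const_mul ((B - 2 * s) / 2))).congr_deriv ?_
    have h1 := Real.sin_sq_add_cos_sq (w * Real.log r)
    simp only [hG']
    generalize Real.sin (w * Real.log r) = S at *
    generalize Real.cos (w * Real.log r) = K at *
    field_simp
    linear_combination (3 * w) * h1
  have hcongr : ∀ r ∈ Ioo 1 R, (-A * r ^ (2 * s - 1) * (φ r) ^ 2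
      + B * r ^ (2 * s) * (φ r) * (deriv φ r) + r ^ (2 * s + 1) * (deriv φ r) ^ 2) = G' r := by
    intro r hr
    have hr0 : 0 < r := by linarith [hr.1]
    rw [hin r ⟨hr.1.le, hr.2.le⟩, hdin r hr]
    simp only [hg, hg', hG']
    have hx : 0 < r ^ s := Real.rpow_pos_of_pos hr0 s
    rw [Real.rpow_sub_one hr0.ne', Real.rpow_add_one hr0.ne', Real.rpow_neg hr0.le,
      two_mul s, Real.rpow_add hr0]
    generalize r ^ s = x at *
    generalize Real.sin (w * Real.log r) = S at *
    generalize Real.cos (w * Real.log r) = K at *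
    field_simp
    linear_combination S ^ 2 * hq
  rw [setIntegral_congr_fun measurableSet_Ioo hcongr, ← integral_Ioc_eq_integral_Ioo,
    ← intervalIntegral.integral_of_le h1R.le]
  have hG'c : ContinuousOn G' (uIcc 1 R) := by
    rw [uIcc_of_le h1R.le]
    intro r hr
    have hr0 : r ≠ 0 := by linarith [hr.1]
    refine ContinuousAt.continuousWithinAt ?_
    have hwl : ContinuousAt (fun r : ℝ => w * Real.log r) r :=
      continuousAt_const.mul (Real.continuousAt_log hr0)
    have hc : ContinuousAt (fun r : ℝ => Real.cos (w * Real.log r)) r :=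
      Real.continuous_cos.continuousAt.comp hwl
    have hs : ContinuousAt (fun r : ℝ => Real.sin (w * Real.log r)) r :=
      Real.continuous_sin.continuousAt.comp hwl
    exact (((continuousAt_const.mul (hc.pow 2)).add (continuousAt_const.mul (hs.mul hc))).sub
      (continuousAt_const.mul (hs.pow 2))).div continuousAt_id hr0
  rw [intervalIntegral.integral_eq_sub_of_hasDerivAt (f := G)
    (fun r hr => hGd r (by rw [uIcc_of_le h1R.le] at hr; linarith [hr.1]))
    hG'c.intervalIntegrable]
  have hwp : w * (Real.pi / w) = Real.pi := by field_simp
  have e1 : G 1 = 0 := by simp [hG]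
  have e2 : G R = -(3 * w / 2 * Real.pi) := by
    simp only [hG, hR, Real.log_exp, hwp, Real.sin_pi]
    field_simp
    ring
  rw [e1, e2]
  have := mul_pos hw Real.pi_pos
  linarith

/-- Final step of the flatness proposition for `a`-stable minimal cones: for
`a > max{1, (n-2)²/(4(n-1))}` there is a compactly supported Lipschitz function on
`(0,∞)` making the one-dimensional cone stability form negative. -/
theorem stmt_19 (n : ℕ) (hn : 2 ≤ n) (a : ℝ)
    (ha : max 1 (((n : ℝ) - 2) ^ 2 / (4 * ((n : ℝ) - 1))) < a) :
    ∃ φ : ℝ → ℝ, (∃ K, LipschitzWith K φ) ∧ HasCompactSupport φ ∧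
      tsupport φ ⊆ Set.Ioi (0 : ℝ) ∧
      (∫ r in Set.Ioi (0 : ℝ),
        (-((8 * a ^ 3 + 3 * a ^ 2 - 2 * a - 1) / (4 * a ^ 2))
            * r ^ (((n : ℝ) * a - 4 * a - 1) / a) * (φ r) ^ 2
          + ((2 * a ^ 2 - a - 1) / a) * r ^ (((n : ℝ) * a - 3 * a - 1) / a)
            * (φ r) * (deriv φ r)
          + r ^ (((n : ℝ) * a - 2 * a - 1) / a) * (deriv φ r) ^ 2)) < 0 := by
  have ha1 : 1 < a := (le_max_left _ _).trans_lt ha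
  have ha2 := (le_max_right _ _).trans_lt ha
  have hn' : (2 : ℝ) ≤ n := by exact_mod_cast hn
  have ha0 : a ≠ 0 := by linarith
  rw [div_lt_iff₀ (by linarith)] at ha2
  have hd : 0 < (((n : ℝ) - 1) * a - ((n : ℝ) - 2) ^ 2 / 4) / 4 := by linarith
  obtain ⟨φ, h1, h2, h3, h4⟩ := aux_main (((n : ℝ) - 3 - 1 / a) / 2) ((2 * a ^ 2 - a - 1) / a)
    ((8 * a ^ 3 + 3 * a ^ 2 - 2 * a - 1) / (4 * a ^ 2)) (Real.sqrt _) (Real.sqrt_pos.mpr hd) (by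
      rw [Real.sq_sqrt hd.le]
      field_simp
      ring)
  refine ⟨φ, h1, h2, h3, ?_⟩
  have p1 : ((n : ℝ) * a - 4 * a - 1) / a = 2 * (((n : ℝ) - 3 - 1 / a) / 2) - 1 := by
    field_simp
    ring
  have p2 : ((n : ℝ) * a - 3 * a - 1) / a = 2 * (((n : ℝ) - 3 - 1 / a) / 2) := by
    field_simp
  have p3 : ((n : ℝ) * a - 2 * a - 1) / a = 2 * (((n : ℝ) - 3 - 1 / a) / 2) + 1 := by
    field_simp
    ring
  rw [p1, p2, p3]
  exact h4
end
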